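/- (One-step time derivative estimate) Assume (A1). Fix n ∈ ℕ and let (U^{α,n}_i) be given with |p^{α,n}_{i,+}| ≤ C^n for all i ≥ 0 and α = 1,…,N, for some constant C^n > 0; let (U^{α,n+1}_i) and (U^{α,n+2}_i) be computed from it by the scheme (NS). For σ ∈ {+,−} let I^{α,n}_{i,σ} be the closed interval with endpoints p^{α,n}_{i,σ} and p^{α,n+1}_{i,σ}, and set D^{α,n}_{i,+} = sup{|H′_α(p)| : p ∈ I^{α,n}_{i,+}}. If D^{α,n}_{i,+} ≤ Δx/Δt for all i ≥ 0 and all α, then m^n ≤ m^{n+1} ≤ M^{n+1} ≤ M^n, where m^k = inf{W^{α,k}_i : α, i} and M^k = sup{W^{α,k}_i : α, i}. -/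

import Mathlib

open Set Filter

/-- Assumption (A1) for a single Hamiltonian: `H` is `C¹`, coercive
(`H p → +∞` as `|p| → +∞`), non-increasing on `(-∞, p₀]` and non-decreasing on `[p₀, +∞)`. -/
def A1cond (H : ℝ → ℝ) (p₀ : ℝ) : Prop :=
  ContDiff ℝ 1 H ∧ Tendsto H (cocompact ℝ) atTop ∧
    AntitoneOn H (Iic p₀) ∧ MonotoneOn H (Ici p₀)

/-- The non-increasing envelope `H⁻` of `H` with turning point `p₀`. -/
noncomputable def Hm (H : ℝ → ℝ) (p₀ : ℝ) (p : ℝ) : ℝ :=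
  if p ≤ p₀ then H p else H p₀

/-- The non-decreasing envelope `H⁺` of `H` with turning point `p₀`. -/
noncomputable def Hp (H : ℝ → ℝ) (p₀ : ℝ) (p : ℝ) : ℝ :=
  if p ≤ p₀ then H p₀ else H p

/-- One time step of the numerical scheme (NS) on the junction:
`V` (the values at time `n+1`) is computed from `U` (the values at time `n`).
For `i ≥ 1` on each branch `α` the update uses
`max (H⁺_α(p_{i,-}), H⁻_α(p_{i,+}))`; at the junction point `i = 0` all branches share a
common value and the update uses `max_β H⁻_β(p^β_{0,+})`. -/
def SchemeStep {N : ℕ} (H : Fin N → ℝ → ℝ) (p₀ : Fin N → ℝ) (Δx Δt : ℝ)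
    (U V : Fin N → ℕ → ℝ) : Prop :=
  (∀ (α : Fin N) (i : ℕ), 1 ≤ i →
      V α i = U α i - Δt * max (Hp (H α) (p₀ α) ((U α i - U α (i - 1)) / Δx))
        (Hm (H α) (p₀ α) ((U α (i + 1) - U α i) / Δx))) ∧
  (∀ α β : Fin N, U α 0 = U β 0) ∧
  (∀ α : Fin N, V α 0 = U α 0 - Δt *
      sSup (Set.range fun β : Fin N => Hm (H β) (p₀ β) ((U β 1 - U β 0) / Δx)))

/-- The numerical scheme (NS): `U α n i` is the value on branch `α` at time step `n`
and grid point `i`. -/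
def SchemeNS {N : ℕ} (H : Fin N → ℝ → ℝ) (p₀ : Fin N → ℝ) (Δx Δt : ℝ)
    (U : Fin N → ℕ → ℕ → ℝ) : Prop :=
  ∀ n : ℕ, SchemeStep H p₀ Δx Δt (fun α i => U α n i) (fun α i => U α (n + 1) i)

lemma Hp_monotone {H : ℝ → ℝ} {p₀ : ℝ} (h : A1cond H p₀) : Monotone (Hp H p₀) := by
  obtain ⟨-, -, -, hm⟩ := h
  intro a b hab
  unfold Hp
  split_ifs with ha hb hb
  · exact le_rfl
  · exact hm self_mem_Ici (not_le.1 hb).le (not_le.1 hb).le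
  · exact absurd (hab.trans hb) ha
  · exact hm (not_le.1 ha).le (not_le.1 hb).le hab

lemma Hm_antitone {H : ℝ → ℝ} {p₀ : ℝ} (h : A1cond H p₀) : Antitone (Hm H p₀) := by
  obtain ⟨-, -, hm, -⟩ := h
  intro a b hab
  unfold Hm
  split_ifs with hb ha ha
  · exact hm ha hb hab
  · exact absurd (hab.trans hb) ha
  · exact hm ha self_mem_Iic ha
  · exact le_rfl

/-- Mean value inequality on a subinterval of an interval where the derivative is bounded. -/
lemma A1cond.abs_sub_le {H : ℝ → ℝ} {p₀ a b c d L : ℝ} (h : A1cond H p₀)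
    (hL : ∀ p ∈ Icc a b, |deriv H p| ≤ L) (hac : a ≤ c) (hcd : c ≤ d) (hdb : d ≤ b) :
    |H d - H c| ≤ L * (d - c) := by
  have key := (convex_Icc a b).norm_image_sub_le_of_norm_deriv_le (f := H)
    (fun x _ => (h.1.differentiable one_ne_zero) x) hL
    (⟨hac, hcd.trans hdb⟩ : c ∈ Icc a b) (⟨hac.trans hcd, hdb⟩ : d ∈ Icc a b)
  rwa [Real.norm_eq_abs, Real.norm_eq_abs, abs_of_nonneg (sub_nonneg.2 hcd)] at key

lemma Hp_sub_le {H : ℝ → ℝ} {p₀ a b L : ℝ} (h : A1cond H p₀) (hab : a ≤ b)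
    (hL : ∀ p ∈ Icc a b, |deriv H p| ≤ L) : Hp H p₀ b - Hp H p₀ a ≤ L * (b - a) := by
  have hL0 : 0 ≤ L := (abs_nonneg _).trans (hL a (left_mem_Icc.2 hab))
  unfold Hp
  split_ifs with hb ha ha
  · nlinarith
  · exact absurd (hab.trans hb) ha
  · have := (abs_le.1 (h.abs_sub_le hL ha (not_le.1 hb).le le_rfl)).2
    nlinarith
  · exact (abs_le.1 (h.abs_sub_le hL le_rfl hab le_rfl)).2

lemma Hm_sub_le {H : ℝ → ℝ} {p₀ a b L : ℝ} (h : A1cond H p₀) (hab : a ≤ b)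
    (hL : ∀ p ∈ Icc a b, |deriv H p| ≤ L) : Hm H p₀ a - Hm H p₀ b ≤ L * (b - a) := by
  have hL0 : 0 ≤ L := (abs_nonneg _).trans (hL a (left_mem_Icc.2 hab))
  unfold Hm
  split_ifs with ha hb hb
  · have := (abs_le.1 (h.abs_sub_le hL le_rfl hab le_rfl)).1
    linarith
  · have := (abs_le.1 (h.abs_sub_le hL le_rfl ha (not_le.1 hb).le)).1
    nlinarith
  · exact absurd (hab.trans hb) ha
  · nlinarith

/-- Under the CFL bound, updating `w` through `H⁺` stays between `w` and its left neighbour `v`. -/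
lemma Hp_update_mem_Icc {H : ℝ → ℝ} {p₀ a b L v w m M : ℝ} (h : A1cond H p₀)
    (hL : ∀ p ∈ uIcc a b, |deriv H p| ≤ L) (hvw : L * (b - a) = w - v)
    (hv : v ∈ Icc m M) (hw : w ∈ Icc m M) :
    w + Hp H p₀ a - Hp H p₀ b ∈ Icc m M := by
  obtain ⟨hv1, hv2⟩ := hv
  obtain ⟨hw1, hw2⟩ := hw
  rcases le_total a b with hab | hab
  · rw [uIcc_of_le hab] at hL
    have h1 := Hp_sub_le h hab hL
    have h2 := Hp_monotone h hab
    constructor <;> linarith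
  · rw [uIcc_of_ge hab] at hL
    have h1 := Hp_sub_le h hab hL
    have h2 := Hp_monotone h hab
    constructor <;> linarith

/-- Under the CFL bound, updating `w` through `H⁻` stays between `w` and its right neighbour `v`. -/
lemma Hm_update_mem_Icc {H : ℝ → ℝ} {p₀ a b L v w m M : ℝ} (h : A1cond H p₀)
    (hL : ∀ p ∈ uIcc a b, |deriv H p| ≤ L) (hvw : L * (b - a) = v - w)
    (hv : v ∈ Icc m M) (hw : w ∈ Icc m M) :
    w + Hm H p₀ a - Hm H p₀ b ∈ Icc m M := by
  obtain ⟨hv1, hv2⟩ := hv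
  obtain ⟨hw1, hw2⟩ := hw
  rcases le_total a b with hab | hab
  · rw [uIcc_of_le hab] at hL
    have h1 := Hm_sub_le h hab hL
    have h2 := Hm_antitone h hab
    constructor <;> linarith
  · rw [uIcc_of_ge hab] at hL
    have h1 := Hm_sub_le h hab hL
    have h2 := Hm_antitone h hab
    constructor <;> linarith

lemma Monotone.abs_le_of_abs_le {f : ℝ → ℝ} (hf : Monotone f) {p C : ℝ} (hp : |p| ≤ C) :
    |f p| ≤ |f C| + |f (-C)| := by
  have h1 := hf (abs_le.1 hp).1
  have h2 := hf (abs_le.1 hp).2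
  have := neg_abs_le (f (-C))
  have := le_abs_self (f C)
  have := abs_nonneg (f C)
  have := abs_nonneg (f (-C))
  exact abs_le.2 ⟨by linarith, by linarith⟩

lemma sSup_range_add_sub_mem_Icc {ι : Type*} [Finite ι] [Nonempty ι] {f g : ι → ℝ} {w m M : ℝ}
    (h : ∀ i, w + f i - g i ∈ Icc m M) :
    w + sSup (range f) - sSup (range g) ∈ Icc m M := by
  have hf : ∀ i, f i ≤ sSup (range f) := fun i =>
    le_csSup (finite_range f).bddAbove (mem_range_self i)
  have hg : ∀ i, g i ≤ sSup (range g) := fun i =>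
    le_csSup (finite_range g).bddAbove (mem_range_self i)
  have h1 : sSup (range g) ≤ w + sSup (range f) - m := by
    refine csSup_le (range_nonempty g) ?_
    rintro _ ⟨i, rfl⟩
    linarith [(h i).1, hf i]
  have h2 : sSup (range f) ≤ M - w + sSup (range g) := by
    refine csSup_le (range_nonempty f) ?_
    rintro _ ⟨i, rfl⟩
    linarith [(h i).2, hg i]
  constructor <;> linarith

lemma max_add_sub_mem_Icc {x y x' y' w m M : ℝ} (hx : w + x - x' ∈ Icc m M)
    (hy : w + y - y' ∈ Icc m M) : w + max x y - max x' y' ∈ Icc m M := by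
  obtain ⟨hx1, hx2⟩ := hx
  obtain ⟨hy1, hy2⟩ := hy
  have h1 : max x' y' ≤ w + max x y - m :=
    max_le (by linarith [le_max_left x y]) (by linarith [le_max_right x y])
  have h2 : max x y ≤ M - w + max x' y' :=
    max_le (by linarith [le_max_left x' y']) (by linarith [le_max_right x' y'])
  constructor <;> linarith

/-- Bounded discrete gradients give bounded discrete time derivatives. -/
lemma SchemeStep.exists_abs_le {N : ℕ} {H : Fin N → ℝ → ℝ} {p₀ : Fin N → ℝ}
    (hA1 : ∀ α, A1cond (H α) (p₀ α)) {Δx Δt : ℝ} (hΔt : 0 < Δt) {U V : Fin N → ℕ → ℝ}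
    (hstep : SchemeStep H p₀ Δx Δt U V) {C : ℝ}
    (hgrad : ∀ (α : Fin N) (i : ℕ), |(U α (i + 1) - U α i) / Δx| ≤ C) :
    ∃ K, ∀ α i, |(V α i - U α i) / Δt| ≤ K := by
  obtain ⟨hi, -, h0⟩ := hstep
  let k : Fin N → ℝ := fun α =>
    (|Hp (H α) (p₀ α) C| + |Hp (H α) (p₀ α) (-C)|) +
      (|Hm (H α) (p₀ α) C| + |Hm (H α) (p₀ α) (-C)|)
  have hkp : ∀ α p, |p| ≤ C → |Hp (H α) (p₀ α) p| ≤ k α := fun α p hp =>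
    ((Hp_monotone (hA1 α)).abs_le_of_abs_le hp).trans
      (le_add_of_nonneg_right (by positivity))
  have hkm : ∀ α p, |p| ≤ C → |Hm (H α) (p₀ α) p| ≤ k α := fun α p hp => by
    have := (Hm_antitone (hA1 α)).neg.abs_le_of_abs_le hp
    rw [abs_neg, abs_neg, abs_neg] at this
    exact this.trans (le_add_of_nonneg_left (by positivity))
  have hkK : ∀ α, k α ≤ ∑ β, k β := fun α =>
    Finset.single_le_sum (fun β _ => by positivity) (Finset.mem_univ α)
  refine ⟨∑ β, k β, fun α i => ?_⟩
  rcases i with _ | i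
  · have : Nonempty (Fin N) := ⟨α⟩
    have e : (V α 0 - U α 0) / Δt =
        -sSup (range fun β : Fin N => Hm (H β) (p₀ β) ((U β 1 - U β 0) / Δx)) := by
      rw [h0 α]; field_simp; ring
    rw [e, abs_neg]
    have hb := fun β => abs_le.1 ((hkm β _ (hgrad β 0)).trans (hkK β))
    refine abs_le.2 ⟨?_, ?_⟩
    · exact (hb α).1.trans (le_csSup (finite_range _).bddAbove (mem_range_self α))
    · refine csSup_le (range_nonempty _) ?_
      rintro _ ⟨β, rfl⟩
      exact (hb β).2
  · have e : (V α (i + 1) - U α (i + 1)) / Δt =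
        -max (Hp (H α) (p₀ α) ((U α (i + 1) - U α i) / Δx))
          (Hm (H α) (p₀ α) ((U α (i + 1 + 1) - U α (i + 1)) / Δx)) := by
      rw [hi α (i + 1) (by omega), Nat.add_sub_cancel]; field_simp; ring
    rw [e, abs_neg]
    exact abs_max_le_max_abs_abs.trans (max_le ((hkp α _ (hgrad α i)).trans (hkK α))
      ((hkm α _ (hgrad α (i + 1))).trans (hkK α)))

/-- Any bounds on the discrete time derivatives are propagated by one step of the scheme. -/
lemma SchemeStep.mem_Icc_of_mem_Icc {N : ℕ} {H : Fin N → ℝ → ℝ} {p₀ : Fin N → ℝ}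
    (hA1 : ∀ α, A1cond (H α) (p₀ α)) {Δx Δt : ℝ} (hΔx : 0 < Δx) (hΔt : 0 < Δt)
    {U V X : Fin N → ℕ → ℝ} (hUV : SchemeStep H p₀ Δx Δt U V)
    (hVX : SchemeStep H p₀ Δx Δt V X)
    (hD : ∀ (α : Fin N) (i : ℕ),
      ∀ p ∈ uIcc ((U α (i + 1) - U α i) / Δx) ((V α (i + 1) - V α i) / Δx),
        |deriv (H α) p| ≤ Δx / Δt)
    {m M : ℝ} (hmM : ∀ α i, (V α i - U α i) / Δt ∈ Icc m M) (α : Fin N) (i : ℕ) :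
    (X α i - V α i) / Δt ∈ Icc m M := by
  obtain ⟨hUVi, hU0, hUV0⟩ := hUV
  obtain ⟨hVXi, hV0, hVX0⟩ := hVX
  have hgap : ∀ β j, Δx / Δt * ((V β (j + 1) - V β j) / Δx - (U β (j + 1) - U β j) / Δx) =
      (V β (j + 1) - U β (j + 1)) / Δt - (V β j - U β j) / Δt := fun β j => by
    field_simp; ring
  rcases i with _ | i
  · have : Nonempty (Fin N) := ⟨α⟩
    have key := sSup_range_add_sub_mem_Icc (w := (V α 0 - U α 0) / Δt) (m := m) (M := M)
      (f := fun β => Hm (H β) (p₀ β) ((U β 1 - U β 0) / Δx))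
      (g := fun β => Hm (H β) (p₀ β) ((V β 1 - V β 0) / Δx)) fun β => by
        rw [hV0 α β, hU0 α β]
        exact Hm_update_mem_Icc (hA1 β) (hD β 0) (hgap β 0) (hmM β 1) (hmM β 0)
    convert key using 1
    have e : (V α 0 - U α 0) / Δt =
        -sSup (range fun β : Fin N => Hm (H β) (p₀ β) ((U β 1 - U β 0) / Δx)) := by
      rw [hUV0 α]; field_simp; ring
    rw [e, hVX0 α]
    field_simp
    ring
  · have key := max_add_sub_mem_Icc
      (Hp_update_mem_Icc (hA1 α) (hD α i) (hgap α i) (hmM α i) (hmM α (i + 1)))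
      (Hm_update_mem_Icc (hA1 α) (hD α (i + 1)) (hgap α (i + 1)) (hmM α (i + 1 + 1))
        (hmM α (i + 1)))
    convert key using 1
    have e : (V α (i + 1) - U α (i + 1)) / Δt =
        -max (Hp (H α) (p₀ α) ((U α (i + 1) - U α i) / Δx))
          (Hm (H α) (p₀ α) ((U α (i + 1 + 1) - U α (i + 1)) / Δx)) := by
      rw [hUVi α (i + 1) (by omega), Nat.add_sub_cancel]; field_simp; ring
    rw [e, hVXi α (i + 1) (by omega), Nat.add_sub_cancel]
    field_simp
    ring

/-- **One-step time derivative estimate** (Proposition 2.1).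
Assume (A1). Given values `Un` at step `n` with bounded discrete gradients
(`|p^{α,n}_{i,+}| ≤ Cn`), let `Un1` and `Un2` be computed by the scheme (NS).
If `D^{α,n}_{i,+} = sup{|H'_α(p)| : p` between `p^{α,n}_{i,+}` and `p^{α,n+1}_{i,+}} ≤ Δx/Δt`
for all `i` and `α`, then `m^n ≤ m^{n+1} ≤ M^{n+1} ≤ M^n`, where `m^k` (resp. `M^k`)
is the infimum (resp. supremum) of the discrete time derivatives at step `k`. -/
theorem one_step_time_derivative_estimate {N : ℕ} (hN : 1 ≤ N)
    (H : Fin N → ℝ → ℝ) (p₀ : Fin N → ℝ)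
    (hA1 : ∀ α, A1cond (H α) (p₀ α))
    (Δx Δt : ℝ) (hΔx : 0 < Δx) (hΔt : 0 < Δt)
    (Un Un1 Un2 : Fin N → ℕ → ℝ)
    (hstep1 : SchemeStep H p₀ Δx Δt Un Un1)
    (hstep2 : SchemeStep H p₀ Δx Δt Un1 Un2)
    (Cn : ℝ) (hCn : 0 < Cn)
    (hgrad : ∀ (α : Fin N) (i : ℕ), |(Un α (i + 1) - Un α i) / Δx| ≤ Cn)
    (hD : ∀ (α : Fin N) (i : ℕ),
      ∀ p ∈ uIcc ((Un α (i + 1) - Un α i) / Δx) ((Un1 α (i + 1) - Un1 α i) / Δx),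
        |deriv (H α) p| ≤ Δx / Δt) :
    sInf (Set.range fun q : Fin N × ℕ => (Un1 q.1 q.2 - Un q.1 q.2) / Δt) ≤
        sInf (Set.range fun q : Fin N × ℕ => (Un2 q.1 q.2 - Un1 q.1 q.2) / Δt) ∧
      sInf (Set.range fun q : Fin N × ℕ => (Un2 q.1 q.2 - Un1 q.1 q.2) / Δt) ≤
        sSup (Set.range fun q : Fin N × ℕ => (Un2 q.1 q.2 - Un1 q.1 q.2) / Δt) ∧
      sSup (Set.range fun q : Fin N × ℕ => (Un2 q.1 q.2 - Un1 q.1 q.2) / Δt) ≤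
        sSup (Set.range fun q : Fin N × ℕ => (Un1 q.1 q.2 - Un q.1 q.2) / Δt) := by
  have : Nonempty (Fin N) := ⟨⟨0, hN⟩⟩
  obtain ⟨K, hK⟩ := hstep1.exists_abs_le hA1 hΔt hgrad
  have hbelow : BddBelow (range fun q : Fin N × ℕ => (Un1 q.1 q.2 - Un q.1 q.2) / Δt) :=
    ⟨-K, by rintro _ ⟨q, rfl⟩; exact (abs_le.1 (hK q.1 q.2)).1⟩
  have habove : BddAbove (range fun q : Fin N × ℕ => (Un1 q.1 q.2 - Un q.1 q.2) / Δt) :=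
    ⟨K, by rintro _ ⟨q, rfl⟩; exact (abs_le.1 (hK q.1 q.2)).2⟩
  have hmem := SchemeStep.mem_Icc_of_mem_Icc hA1 hΔx hΔt hstep1 hstep2 hD fun α i =>
    ⟨csInf_le hbelow (mem_range_self (α, i)), le_csSup habove (mem_range_self (α, i))⟩
  refine ⟨le_csInf (range_nonempty _) ?_, Real.sInf_le_sSup _ ?_ ?_,
    csSup_le (range_nonempty _) ?_⟩
  · rintro _ ⟨q, rfl⟩
    exact (hmem q.1 q.2).1
  · exact ⟨_, by rintro _ ⟨q, rfl⟩; exact (hmem q.1 q.2).1⟩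
  · exact ⟨_, by rintro _ ⟨q, rfl⟩; exact (hmem q.1 q.2).2⟩
  · rintro _ ⟨q, rfl⟩
    exact (hmem q.1 q.2).2
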